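/- arXiv:2503.14961 — 5 statements merged into one kernel-verified Lean document; each statement's English description precedes it below -/
import Mathlib

section
/- Let X be a normal (T4) topological space and let ζ be a real-valued functional on the space of bounded continuous functions X → ℝ satisfying ζ(F + λ) = ζ(F) + λ for every bounded continuous F and every constant λ ∈ ℝ. Suppose K₁, K₂ ⊆ X are closed, K₁ is ζ-superheavy (ζ(F) = 0 for every bounded continuous F ≤ 0 vanishing identically on K₁) and K₂ is ζ-heavy (ζ(F) = 0 for every bounded continuous F ≥ 0 vanishing identically on K₂). Then K₁ ∩ K₂ ≠ ∅. -/
open BoundedContinuousFunction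

/-- In a normal (T4) space, given a functional `ζ` on bounded continuous functions with
the shift property, a closed `ζ`-superheavy set meets every closed `ζ`-heavy set. -/
theorem stmt_6 {X : Type*} [TopologicalSpace X] [T4Space X]
    (ζ : (X →ᵇ ℝ) → ℝ)
    (hshift : ∀ (F : X →ᵇ ℝ) (l : ℝ),
      ζ (F + BoundedContinuousFunction.const X l) = ζ F + l)
    (K₁ K₂ : Set X) (h1 : IsClosed K₁) (h2 : IsClosed K₂)
    (hsuper : ∀ F : X →ᵇ ℝ, F ≤ 0 → (∀ x ∈ K₁, F x = 0) → ζ F = 0)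
    (hheavy : ∀ F : X →ᵇ ℝ, 0 ≤ F → (∀ x ∈ K₂, F x = 0) → ζ F = 0) :
    (K₁ ∩ K₂).Nonempty := by
  by_contra hne
  have hd : Disjoint K₂ K₁ := by
    rw [Set.disjoint_iff_inter_eq_empty, Set.inter_comm]
    exact Set.not_nonempty_iff_eq_empty.mp hne
  obtain ⟨f, hf2, hf1, hf⟩ := exists_bounded_zero_one_of_closed h2 h1 hd
  have e2 : ζ f = 0 := hheavy f (fun x => (hf x).1) (fun x hx => hf2 hx)
  have e1 : ζ (f + BoundedContinuousFunction.const X (-1)) = 0 := by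
    apply hsuper
    · intro x
      have h := (hf x).2
      change f x + (-1) ≤ 0
      linarith
    · intro x hx
      have h : f x = 1 := hf1 hx
      change f x + (-1) = 0
      linarith
  rw [hshift, e2] at e1
  linarith
end

section
/- Let X be a topological space and let c be a real-valued functional on the space of bounded continuous functions X → ℝ satisfying c(F + λ) = c(F) + λ for every bounded continuous F and every constant λ ∈ ℝ. Let n ≥ 0 and let K₀, …, Kₙ ⊆ X be subsets, each c-heavy, i.e. c(F) = 0 for every bounded continuous F : X → ℝ with F ≥ 0 and F identically 0 on Kᵢ. Let H₀, …, Hₙ : X → ℝ be bounded continuous functions with 0 ≤ Hᵢ ≤ 1, Hᵢ identically 1 on Kᵢ, and Hᵢ·Hⱼ = 0 pointwise for all i ≠ j. Then for all real numbers a₀, …, aₙ with a₀ + ⋯ + aₙ = 0 one has c(Σ_{i=0}^n aᵢHᵢ) = min_{0≤i≤n} aᵢ. -/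
open BoundedContinuousFunction

/-- Given a functional `c` with the shift property, pairwise "disjoint" bump functions
`Hᵢ` with `0 ≤ Hᵢ ≤ 1`, `Hᵢ ≡ 1` on a `c`-heavy set `Kᵢ`, and any zero-sum coefficients
`a₀,…,aₙ`, the value of `c` on `Σ aᵢHᵢ` is the smallest coefficient. -/
theorem stmt_7 {X : Type*} [TopologicalSpace X] (c : (X →ᵇ ℝ) → ℝ)
    (hshift : ∀ (F : X →ᵇ ℝ) (l : ℝ),
      c (F + BoundedContinuousFunction.const X l) = c F + l)
    (n : ℕ) (K : Fin (n + 1) → Set X)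
    (hheavy : ∀ i, ∀ F : X →ᵇ ℝ, 0 ≤ F → (∀ x ∈ K i, F x = 0) → c F = 0)
    (H : Fin (n + 1) → (X →ᵇ ℝ))
    (hH0 : ∀ i, 0 ≤ H i) (hH1 : ∀ i, H i ≤ 1)
    (hHK : ∀ i, ∀ x ∈ K i, H i x = 1)
    (hdisj : ∀ i j, i ≠ j → ∀ x, H i x * H j x = 0) :
    ∀ a : Fin (n + 1) → ℝ, (∑ i, a i) = 0 →
      c (∑ i, a i • H i) = ⨅ i, a i := by
  intro a ha
  obtain ⟨i0, hi0⟩ := Finite.exists_min a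
  have hm : (⨅ i, a i) = a i0 :=
    le_antisymm (ciInf_le (Set.finite_range a).bddBelow i0) (le_ciInf hi0)
  have hneg : a i0 ≤ 0 := by
    by_contra hcon
    have hpos : 0 < ∑ i, a i :=
      Finset.sum_pos (fun i _ => lt_of_lt_of_le (not_le.mp hcon) (hi0 i)) Finset.univ_nonempty
    linarith
  have hsingle : ∀ x j, H j x ≠ 0 → (∑ i, a i • H i) x = a j * H j x := by
    intro x j hj
    rw [BoundedContinuousFunction.sum_apply, Finset.sum_eq_single j]
    · simp
    · intro b _ hb
      have h := (mul_eq_zero.mp (hdisj b j hb x)).resolve_right hj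
      simp [h]
    · simp
  have key := hheavy i0 (∑ i, a i • H i + BoundedContinuousFunction.const X (-a i0)) ?_ ?_
  · rw [hshift] at key
    rw [hm]
    linarith
  · intro x
    change (0 : ℝ) ≤ (∑ i, a i • H i) x + (-a i0)
    by_cases hx : ∃ j, H j x ≠ 0
    · obtain ⟨j, hj⟩ := hx
      rw [hsingle x j hj]
      have h0 : (0 : ℝ) ≤ H j x := hH0 j x
      have h1 : H j x ≤ (1 : ℝ) := hH1 j x
      nlinarith [mul_nonneg (sub_nonneg.mpr (hi0 j)) h0,
        mul_nonneg (neg_nonneg.mpr hneg) (sub_nonneg.mpr h1)]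
    · push Not at hx
      rw [BoundedContinuousFunction.sum_apply]
      simp [hx, hneg]
  · intro x hx
    have h1 := hHK i0 x hx
    change (∑ i, a i • H i) x + (-a i0) = 0
    rw [hsingle x i0 (by rw [h1]; exact one_ne_zero), h1]
    ring
end

section
/- Let X be a topological space and let c be a real-valued functional on the space of bounded continuous functions X → ℝ satisfying c(F + λ) = c(F) + λ for every bounded continuous F and every constant λ ∈ ℝ. Let n ≥ 1 and let K₀, …, Kₙ ⊆ X each be c-heavy (c(F) = 0 for every bounded continuous F ≥ 0 vanishing identically on Kᵢ). Let H₀, …, Hₙ : X → ℝ be bounded continuous with 0 ≤ Hᵢ ≤ 1, Hᵢ identically 1 on Kᵢ, and Hᵢ·Hⱼ = 0 pointwise for i ≠ j. For a = (a₁, …, aₙ) ∈ ℝⁿ set a₀ := −(a₁ + ⋯ + aₙ) and F(a) := Σ_{i=0}^n aᵢHᵢ. Then γ(a) := −c(F(a)) − c(−F(a)) = max_{0≤i≤n} aᵢ − min_{0≤i≤n} aᵢ, and ‖a‖∞ ≤ γ(a) ≤ 2n·‖a‖∞, where ‖a‖∞ := max_{1≤i≤n} |aᵢ|. -/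
open BoundedContinuousFunction

theorem aux_min {X : Type*} [TopologicalSpace X] (c : (X →ᵇ ℝ) → ℝ)
    (hshift : ∀ (F : X →ᵇ ℝ) (l : ℝ),
      c (F + BoundedContinuousFunction.const X l) = c F + l)
    (n : ℕ) (K : Fin (n + 1) → Set X)
    (hheavy : ∀ i, ∀ F : X →ᵇ ℝ, 0 ≤ F → (∀ x ∈ K i, F x = 0) → c F = 0)
    (H : Fin (n + 1) → (X →ᵇ ℝ))
    (hH0 : ∀ i, 0 ≤ H i) (hH1 : ∀ i, H i ≤ 1)
    (hHK : ∀ i, ∀ x ∈ K i, H i x = 1)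
    (hdisj : ∀ i j, i ≠ j → ∀ x, H i x * H j x = 0)
    (b : Fin (n + 1) → ℝ) (k : Fin (n + 1)) (hk : ∀ i, b k ≤ b i) (hk0 : b k ≤ 0) :
    c (∑ i, b i • H i) = b k := by
  have hval : ∀ x, (∑ i, b i • H i : X →ᵇ ℝ) x = ∑ i, b i * H i x := by
    intro x
    simp [BoundedContinuousFunction.coe_sum]
  have hone : ∀ x i, H i x ≠ 0 → (∑ j, b j * H j x) = b i * H i x := by
    intro x i hi
    refine Finset.sum_eq_single i (fun j _ hj => ?_) (by simp)
    have := hdisj j i hj x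
    rcases mul_eq_zero.1 this with h | h
    · simp [h]
    · exact absurd h hi
  have h0 := hheavy k ((∑ i, b i • H i) + BoundedContinuousFunction.const X (-(b k))) ?_ ?_
  · rw [hshift] at h0
    linarith
  · intro x
    have e : ((∑ i, b i • H i) + BoundedContinuousFunction.const X (-(b k))) x
      = (∑ i, b i * H i x) + -(b k) := by
      rw [BoundedContinuousFunction.add_apply, hval]; rfl
    change (0 : ℝ) ≤ ((∑ i, b i • H i) + BoundedContinuousFunction.const X (-(b k))) x
    rw [e]
    by_cases h : ∃ i, H i x ≠ 0
    · obtain ⟨i, hi⟩ := h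
      rw [hone x i hi]
      have h1 : 0 ≤ H i x := hH0 i x
      have h2 : H i x ≤ 1 := hH1 i x
      nlinarith [hk i, mul_nonneg (sub_nonneg.2 (hk i)) h1,
        mul_nonneg (neg_nonneg.2 hk0) (sub_nonneg.2 h2)]
    · push Not at h
      simp [h, hk0]
  · intro x hx
    rw [BoundedContinuousFunction.add_apply, hval, hone x k (by rw [hHK k x hx]; norm_num),
      hHK k x hx]
    simp

/-- Rank-`n` quasi-flat computation: with `a₀ := −(a₁+⋯+aₙ)`, `F(a) = Σ aᵢHᵢ` and
`γ(a) = −c(F(a)) − c(−F(a))`, one has `γ(a) = max aᵢ − min aᵢ` and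
`‖a‖∞ ≤ γ(a) ≤ 2n‖a‖∞`. -/
theorem stmt_8 {X : Type*} [TopologicalSpace X] (c : (X →ᵇ ℝ) → ℝ)
    (hshift : ∀ (F : X →ᵇ ℝ) (l : ℝ),
      c (F + BoundedContinuousFunction.const X l) = c F + l)
    (n : ℕ) (hn : 1 ≤ n) (K : Fin (n + 1) → Set X)
    (hheavy : ∀ i, ∀ F : X →ᵇ ℝ, 0 ≤ F → (∀ x ∈ K i, F x = 0) → c F = 0)
    (H : Fin (n + 1) → (X →ᵇ ℝ))
    (hH0 : ∀ i, 0 ≤ H i) (hH1 : ∀ i, H i ≤ 1)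
    (hHK : ∀ i, ∀ x ∈ K i, H i x = 1)
    (hdisj : ∀ i j, i ≠ j → ∀ x, H i x * H j x = 0) :
    ∀ a : Fin n → ℝ,
      let b : Fin (n + 1) → ℝ := Fin.cons (-(∑ j, a j)) a
      let F : X →ᵇ ℝ := ∑ i, b i • H i
      let γ : ℝ := -c F - c (-F)
      γ = (⨆ i, b i) - (⨅ i, b i) ∧
        (⨆ i, |a i|) ≤ γ ∧ γ ≤ 2 * n * ⨆ i, |a i| := by
  intro a b F γ
  have hsum : ∑ i, b i = 0 := by
    simp [b, Fin.sum_univ_succ]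
  obtain ⟨k, hk⟩ := Finite.exists_min b
  obtain ⟨m, hm⟩ := Finite.exists_max b
  have hk0 : b k ≤ 0 := by
    by_contra h
    have : 0 < ∑ i, b i :=
      Finset.sum_pos (fun i _ => lt_of_lt_of_le (not_le.1 h) (hk i)) Finset.univ_nonempty
    linarith
  have hm0 : 0 ≤ b m := by
    by_contra h
    have : 0 < ∑ i, -b i :=
      Finset.sum_pos (fun i _ => by linarith [hm i, not_le.1 h]) Finset.univ_nonempty
    rw [Finset.sum_neg_distrib] at this
    linarith
  have c1 : c F = b k := aux_min c hshift n K hheavy H hH0 hH1 hHK hdisj b k hk hk0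
  have c2 : c (-F) = -b m := by
    have := aux_min c hshift n K hheavy H hH0 hH1 hHK hdisj (fun i => -b i) m
      (fun i => neg_le_neg (hm i)) (by simpa using hm0)
    rw [← this]
    congr 1
    ext x
    simp [F, BoundedContinuousFunction.coe_sum]
  have hγ : γ = b m - b k := by
    simp only [γ, c1, c2]; ring
  have hs : (⨆ i, b i) = b m :=
    le_antisymm (ciSup_le hm) (le_ciSup (Set.finite_range b).bddAbove m)
  have hi : (⨅ i, b i) = b k :=
    le_antisymm (ciInf_le (Set.finite_range b).bddBelow k) (le_ciInf hk)
  haveI : Nonempty (Fin n) := ⟨⟨0, hn⟩⟩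
  have hbs : ∀ i : Fin n, b i.succ = a i := fun i => by simp [b]
  refine ⟨by rw [hγ, hs, hi], ?_, ?_⟩
  · refine ciSup_le fun i => ?_
    have h1 := hk i.succ
    have h2 := hm i.succ
    rw [hbs] at h1 h2
    rw [hγ, abs_le]
    constructor <;> linarith
  · set N := ⨆ i, |a i| with hN
    have hle : ∀ i, |a i| ≤ N := fun i => le_ciSup (Set.finite_range fun i => |a i|).bddAbove i
    have hN0 : 0 ≤ N := (abs_nonneg _).trans (hle ⟨0, hn⟩)
    have hn' : (1 : ℝ) ≤ n := by exact_mod_cast hn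
    have hb : ∀ i, |b i| ≤ n * N := by
      intro i
      refine Fin.cases ?_ (fun j => ?_) i
      · have : b 0 = -∑ j, a j := by simp [b]
        rw [this, abs_neg]
        calc |∑ j, a j| ≤ ∑ j, |a j| := Finset.abs_sum_le_sum_abs _ _
          _ ≤ ∑ _j : Fin n, N := Finset.sum_le_sum fun j _ => hle j
          _ = n * N := by simp
      · rw [hbs]
        nlinarith [hle j]
    rw [hγ]
    linarith [(abs_le.1 (hb m)).2, (abs_le.1 (hb k)).1]
end

section
/- Let X be a topological space and let c be a real-valued functional on the space of bounded continuous functions X → ℝ satisfying c(F + λ) = c(F) + λ for every bounded continuous F and every constant λ ∈ ℝ. Let H : X → ℝ be bounded continuous, and suppose there exist c-heavy subsets K₁, K₂ ⊆ X (meaning c(F) = 0 for every bounded continuous F ≥ 0 vanishing identically on Kᵢ) such that H is identically equal to inf_X H on K₁ and identically equal to sup_X H on K₂. Then c(H) = inf_X H and c(−H) = −sup_X H; in particular −c(H) − c(−H) = sup_X H − inf_X H. -/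
open BoundedContinuousFunction

/-- If a bounded continuous `H` attains its infimum identically on a `c`-heavy set and
its supremum identically on another `c`-heavy set, then `c(H) = inf H`,
`c(−H) = −sup H` and `−c(H) − c(−H) = sup H − inf H`. -/
theorem stmt_10 {X : Type*} [TopologicalSpace X] [Nonempty X]
    (c : (X →ᵇ ℝ) → ℝ)
    (hshift : ∀ (F : X →ᵇ ℝ) (l : ℝ),
      c (F + BoundedContinuousFunction.const X l) = c F + l)
    (H : X →ᵇ ℝ) (K₁ K₂ : Set X)
    (hheavy₁ : ∀ F : X →ᵇ ℝ, 0 ≤ F → (∀ x ∈ K₁, F x = 0) → c F = 0)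
    (hheavy₂ : ∀ F : X →ᵇ ℝ, 0 ≤ F → (∀ x ∈ K₂, F x = 0) → c F = 0)
    (hmin : ∀ x ∈ K₁, H x = ⨅ y, H y)
    (hmax : ∀ x ∈ K₂, H x = ⨆ y, H y) :
    c H = (⨅ y, H y) ∧ c (-H) = -(⨆ y, H y) ∧
      -c H - c (-H) = (⨆ y, H y) - ⨅ y, H y := by
  have hb : BddBelow (Set.range H) := H.isBounded_range.bddBelow
  have ha : BddAbove (Set.range H) := H.isBounded_range.bddAbove
  have h1 : c H = ⨅ y, H y := by
    have h := hshift H (-(⨅ y, H y))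
    rw [hheavy₁ _ ?_ ?_] at h
    · linarith
    · intro x
      have := ciInf_le hb x
      change (0 : ℝ) ≤ H x + -(⨅ y, H y)
      linarith
    · intro x hx
      change H x + -(⨅ y, H y) = 0
      linarith [hmin x hx]
  have h2 : c (-H) = -(⨆ y, H y) := by
    have h := hshift (-H) (⨆ y, H y)
    rw [hheavy₂ _ ?_ ?_] at h
    · linarith
    · intro x
      have := le_ciSup ha x
      change (0 : ℝ) ≤ -H x + (⨆ y, H y)
      linarith
    · intro x hx
      change -H x + (⨆ y, H y) = 0
      linarith [hmax x hx]
  exact ⟨h1, h2, by rw [h1, h2]; ring⟩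
end

section
/- Let X be a topological space and let c be a real-valued functional on the space of bounded continuous functions X → ℝ satisfying: c(0) = 0; c(F + λ) = c(F) + λ for every constant λ ∈ ℝ; if F ≤ G pointwise then c(F) ≤ c(G); and c(F + G) ≥ c(F) + c(G) for all bounded continuous F, G. Let K ⊆ X be c-heavy (c(F) = 0 for every bounded continuous F ≥ 0 vanishing identically on K). Let H : X → ℝ be bounded continuous with H ≤ 0 and H identically 0 on K, and suppose the limit ζ := lim_{m→∞} c(m·H)/m over natural numbers m exists and ζ < 0. Define γ(F) := −c(F) − c(−F). Then there exists a constant C ≥ 0 such that for all a ∈ ℝ: (−ζ/2)·|a| − C ≤ γ(a·H) ≤ 2·‖H‖∞·|a|, where ‖H‖∞ = sup_X |H|. -/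
open BoundedContinuousFunction

/-- Rank-1 quasi-flat estimate: if `K` is `c`-heavy, `H ≤ 0` vanishes on `K`, and
`c(mH)/m → ζ < 0`, then for `γ(F) := −c(F) − c(−F)` there is `C ≥ 0` with
`(−ζ/2)|a| − C ≤ γ(aH) ≤ 2‖H‖∞|a|` for all real `a`. -/
theorem stmt_11 {X : Type*} [TopologicalSpace X] (c : (X →ᵇ ℝ) → ℝ)
    (h0 : c 0 = 0)
    (hshift : ∀ (F : X →ᵇ ℝ) (l : ℝ),
      c (F + BoundedContinuousFunction.const X l) = c F + l)
    (hmono : ∀ F G : X →ᵇ ℝ, F ≤ G → c F ≤ c G)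
    (hsuperadd : ∀ F G : X →ᵇ ℝ, c F + c G ≤ c (F + G))
    (K : Set X)
    (hheavy : ∀ F : X →ᵇ ℝ, 0 ≤ F → (∀ x ∈ K, F x = 0) → c F = 0)
    (H : X →ᵇ ℝ) (hHle : H ≤ 0) (hHK : ∀ x ∈ K, H x = 0)
    (ζ : ℝ)
    (hlim : Filter.Tendsto (fun m : ℕ => c ((m : ℝ) • H) / m)
      Filter.atTop (nhds ζ))
    (hζ : ζ < 0) :
    ∃ C : ℝ, 0 ≤ C ∧ ∀ a : ℝ,
      (-ζ / 2) * |a| - C ≤ -c (a • H) - c (-(a • H)) ∧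
        -c (a • H) - c (-(a • H)) ≤ 2 * ‖H‖ * |a| := by
  have hH : ∀ x, H x ≤ 0 := fun x => hHle x
  have hpos : ∀ t : ℝ, 0 ≤ t → c (-(t • H)) = 0 := by
    intro t ht
    apply hheavy
    · intro x
      have := mul_nonneg ht (neg_nonneg.2 (hH x))
      simp
      linarith
    · intro x hx
      simp [hHK x hx]
  have hanti : ∀ s t : ℝ, s ≤ t → c (t • H) ≤ c (s • H) := by
    intro s t hst
    apply hmono
    intro x
    have := mul_nonneg (sub_nonneg.2 hst) (neg_nonneg.2 (hH x))
    simp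
    nlinarith
  have hlow : ∀ t : ℝ, 0 ≤ t → -(t * ‖H‖) ≤ c (t • H) := by
    intro t ht
    have h1 := hshift 0 (-(t * ‖H‖))
    rw [h0, zero_add, zero_add] at h1
    rw [← h1]
    apply hmono
    intro x
    have h2 : -‖H‖ ≤ H x := (abs_le.1 (H.norm_coe_le_norm x)).1
    have := mul_le_mul_of_nonneg_left h2 ht
    simp
    linarith
  have hev : ∀ᶠ m : ℕ in Filter.atTop, c ((m : ℝ) • H) / m < ζ / 2 :=
    hlim.eventually (gt_mem_nhds (by linarith))
  obtain ⟨N, hN⟩ := Filter.eventually_atTop.1 hev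
  have hf0 : ∀ t : ℝ, 0 ≤ t → c (t • H) ≤ 0 := by
    intro t ht
    have := hanti 0 t ht
    rwa [zero_smul, h0] at this
  have key : ∀ t : ℝ, 0 ≤ t → (-ζ / 2) * t - (-ζ / 2) * (N + 1) ≤ -c (t • H) := by
    intro t ht
    have hfl := Nat.floor_le ht
    have hlt := Nat.lt_floor_add_one t
    by_cases hm : N ≤ ⌊t⌋₊ ∧ 0 < ⌊t⌋₊
    · have h1 := hN _ hm.1
      have hm0 : (0 : ℝ) < (⌊t⌋₊ : ℝ) := by exact_mod_cast hm.2
      rw [div_lt_iff₀ hm0] at h1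
      have h2 := hanti _ _ hfl
      have h3 : (0 : ℝ) ≤ N := Nat.cast_nonneg N
      nlinarith
    · have h4 : ⌊t⌋₊ ≤ N := by omega
      have h5 : (⌊t⌋₊ : ℝ) ≤ N := by exact_mod_cast h4
      have := hf0 t ht
      nlinarith
  have hN0 : (0 : ℝ) ≤ N := Nat.cast_nonneg N
  refine ⟨(-ζ / 2) * (N + 1), mul_nonneg (by linarith) (by linarith), ?_⟩
  have main : ∀ t : ℝ, 0 ≤ t → (-ζ / 2) * t - (-ζ / 2) * (N + 1) ≤ -c (t • H) - c (-(t • H)) ∧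
      -c (t • H) - c (-(t • H)) ≤ 2 * ‖H‖ * t := by
    intro t ht
    rw [hpos t ht, sub_zero]
    refine ⟨key t ht, ?_⟩
    have := hlow t ht
    have := mul_nonneg ht (norm_nonneg H)
    linarith
  intro a
  rcases le_total 0 a with ha | ha
  · rw [abs_of_nonneg ha]
    exact main a ha
  · rw [abs_of_nonpos ha]
    have h := main (-a) (by linarith)
    have e : (-a) • H = -(a • H) := by
      ext x
      simp
    rw [e, neg_neg] at h
    constructor
    · linarith [h.1]
    · linarith [h.2]
end
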